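/- Let Q0 be a probability measure on [0,1] with m := inf supp Q0 > 0. Then the function R̄^{Q0}(β) := ∫_{[0,1]} R(β/a) dQ0(a) is finite for every β ∈ [0,m), satisfies R̄^{Q0}(0) = 0, and is continuous and strictly increasing on [0,m). -/

import Mathlib

open Filter Set MeasureTheory

/-- A power series with nonnegative coefficients which converges on `[0, 1)` is continuous there. -/
theorem continuousOn_tsum_mul_pow_Ico {c : ℕ → ℝ} (hc : ∀ n, 0 ≤ c n)
    (hs : ∀ x ∈ Ico (0 : ℝ) 1, Summable fun n => c n * x ^ n) :
    ContinuousOn (fun x => ∑' n, c n * x ^ n) (Ico (0 : ℝ) 1) := by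
  intro x hx
  obtain ⟨r, hxr, hr1⟩ := exists_between hx.2
  have hcont : ContinuousOn (fun x => ∑' n, c n * x ^ n) (Icc (0 : ℝ) r) := by
    refine continuousOn_tsum (fun n => by fun_prop) (hs r ⟨hx.1.trans hxr.le, hr1⟩) ?_
    intro n y hy
    rw [Real.norm_of_nonneg (mul_nonneg (hc n) (pow_nonneg hy.1 n))]
    exact mul_le_mul_of_nonneg_left (pow_le_pow_left₀ hy.1 hy.2 n) (hc n)
  refine (hcont x ⟨hx.1, hxr.le⟩).mono_of_mem_nhdsWithin ?_
  filter_upwards [self_mem_nhdsWithin, mem_nhdsWithin_of_mem_nhds (Iio_mem_nhds hxr)] with y hy hyr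
  exact ⟨hy.1, le_of_lt hyr⟩

/-- Ratio test on `[0, 1)` for positive coefficients whose successive ratios tend to `1`. -/
theorem summable_mul_pow_of_ratio_tendsto_one {c : ℕ → ℝ} (hc : ∀ᶠ n in atTop, 0 < c n)
    (hr : Tendsto (fun n => c (n + 1) / c n) atTop (nhds 1)) {x : ℝ} (hx : x ∈ Ico (0 : ℝ) 1) :
    Summable fun n => c n * x ^ n := by
  rcases hx.1.eq_or_lt with rfl | hx0
  · exact summable_of_ne_finset_zero (s := {0}) fun n hn => by
      rw [zero_pow (by simpa using hn), mul_zero]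
  · refine summable_of_ratio_test_tendsto_lt_one hx.2 ?_ ?_
    · filter_upwards [hc] with n hn
      positivity
    · have h : Tendsto (fun n => c (n + 1) / c n * x) atTop (nhds x) := by
        simpa using hr.mul_const x
      refine h.congr' ?_
      filter_upwards [hc, (tendsto_add_atTop_nat 1).eventually hc] with n hn hn1
      rw [Real.norm_of_nonneg (by positivity), Real.norm_of_nonneg (by positivity), pow_succ']
      field_simp

/-- The mean of the power-series distribution with weights `w` at parameter `x`. -/
noncomputable def powerSeriesMean (w : ℕ → ℝ) (x : ℝ) : ℝ :=
  (∑' n : ℕ, (n * w n) * x ^ n) / ∑' n, w n * x ^ n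

theorem powerSeriesMean_zero (w : ℕ → ℝ) : powerSeriesMean w 0 = 0 := by
  have h : ∀ n : ℕ, ((n : ℝ) * w n) * 0 ^ n = 0 := by
    intro n
    rcases n with _ | n <;> simp
  simp [powerSeriesMean, h]

section

variable {w : ℕ → ℝ}

theorem tsum_mul_pow_pos (hw : ∀ n, 0 < w n) {x : ℝ} (hx : 0 ≤ x)
    (hs : Summable fun n => w n * x ^ n) : 0 < ∑' n, w n * x ^ n :=
  hs.tsum_pos (fun n => mul_nonneg (hw n).le (pow_nonneg hx n)) 0 (by simpa using hw 0)

theorem continuousOn_powerSeriesMean (hw : ∀ n, 0 < w n)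
    (hs : ∀ x ∈ Ico (0 : ℝ) 1, Summable fun n => w n * x ^ n)
    (hs' : ∀ x ∈ Ico (0 : ℝ) 1, Summable fun n : ℕ => (n * w n) * x ^ n) :
    ContinuousOn (powerSeriesMean w) (Ico (0 : ℝ) 1) :=
  (continuousOn_tsum_mul_pow_Ico (fun n => mul_nonneg n.cast_nonneg (hw n).le) hs').div
    (continuousOn_tsum_mul_pow_Ico (fun n => (hw n).le) hs)
    fun x hx => (tsum_mul_pow_pos hw hx.1 (hs x hx)).ne'

theorem strictMonoOn_powerSeriesMean (hw : ∀ n, 0 < w n)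
    (hs : ∀ x ∈ Ico (0 : ℝ) 1, Summable fun n => w n * x ^ n)
    (hs' : ∀ x ∈ Ico (0 : ℝ) 1, Summable fun n : ℕ => (n * w n) * x ^ n) :
    StrictMonoOn (powerSeriesMean w) (Ico (0 : ℝ) 1) := by
  have hpos : ∀ x ∈ Ico (0 : ℝ) 1, 0 < x → 0 < powerSeriesMean w x := by
    intro x hx hx0
    refine div_pos ?_ (tsum_mul_pow_pos hw hx.1 (hs x hx))
    refine (hs' x hx).tsum_pos (fun n => ?_) 1 ?_
    · have := hw n
      positivity
    · have := hw 1
      simp only [Nat.cast_one, one_mul, pow_one]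
      positivity
  intro x hx y hy hxy
  rcases hx.1.eq_or_lt with rfl | hx0
  · rw [powerSeriesMean_zero]
    exact hpos y hy hxy
  set c := powerSeriesMean w x with hc
  have hc0 : 0 < c := hpos x hx hx0
  have ht : 1 < y / x := (one_lt_div hx0).2 hxy
  have hsub : ∀ z ∈ Ico (0 : ℝ) 1, Summable (fun n : ℕ => (n - c) * w n * z ^ n) ∧
      ∑' n : ℕ, (n - c) * w n * z ^ n
        = (∑' n : ℕ, (n * w n) * z ^ n) - c * ∑' n, w n * z ^ n := by
    intro z hz
    have h := (hs' z hz).hasSum.sub ((hs z hz).hasSum.mul_left c)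
    have h2 : HasSum (fun n : ℕ => (n - c) * w n * z ^ n)
        ((∑' n : ℕ, (n * w n) * z ^ n) - c * ∑' n, w n * z ^ n) := by
      exact h.congr_fun fun n => by ring
    exact ⟨h2.summable, h2.tsum_eq⟩
  have hzero : ∑' n : ℕ, (n - c) * w n * x ^ n = 0 := by
    rw [(hsub x hx).2, hc, powerSeriesMean,
      div_mul_cancel₀ _ (tsum_mul_pow_pos hw hx.1 (hs x hx)).ne', sub_self]
  have hyp : ∀ n : ℕ, (n - c) * w n * y ^ n = ((n - c) * (y / x) ^ (n : ℝ)) * (w n * x ^ n) := by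
    intro n
    rw [Real.rpow_natCast, div_pow]
    field_simp
  have hle : ∀ n : ℕ, (n - c) * (y / x) ^ c ≤ (n - c) * (y / x) ^ (n : ℝ) := by
    intro n
    rcases le_total (n : ℝ) c with h | h
    · exact mul_le_mul_of_nonpos_left (Real.rpow_le_rpow_of_exponent_le ht.le h) (by linarith)
    · exact mul_le_mul_of_nonneg_left (Real.rpow_le_rpow_of_exponent_le ht.le h) (by linarith)
  have hlt : 0 < ∑' n : ℕ, (n - c) * w n * y ^ n := by
    have heq : ∑' n : ℕ, (y / x) ^ c * ((n - c) * w n * x ^ n) = 0 := by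
      rw [tsum_mul_left, hzero, mul_zero]
    rw [← heq]
    refine Summable.tsum_lt_tsum (i := 0) (fun n => ?_) ?_ ((hsub x hx).1.mul_left _) (hsub y hy).1
    · rw [hyp]
      have := mul_le_mul_of_nonneg_right (hle n) (mul_nonneg (hw n).le (pow_nonneg hx0.le n))
      linarith
    · have h1 : 1 < (y / x) ^ c := Real.one_lt_rpow ht hc0
      have := mul_pos hc0 (hw 0)
      simp only [CharP.cast_eq_zero, pow_zero]
      nlinarith
  rw [(hsub y hy).2] at hlt
  rw [powerSeriesMean, lt_div_iff₀ (tsum_mul_pow_pos hw hy.1 (hs y hy))]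
  linarith

end

section

variable {R : ℝ → ℝ} {Q : Measure ℝ} [IsProbabilityMeasure Q] {m : ℝ}

theorem div_mem_Ico_zero_one {m a β : ℝ} (hβ : β ∈ Ico (0 : ℝ) m) (ha : a ∈ Icc m 1) :
    β / a ∈ Ico (0 : ℝ) 1 := by
  have hm : 0 < m := hβ.1.trans_lt hβ.2
  have ha0 : 0 < a := hm.trans_le ha.1
  exact ⟨div_nonneg hβ.1 ha0.le, (div_lt_one ha0).2 (hβ.2.trans_le ha.1)⟩

theorem integrable_comp_div (hR : ContinuousOn R (Ico 0 1)) (hQ : ∀ᵐ a ∂Q, a ∈ Icc m 1)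
    {β : ℝ} (hβ : β ∈ Ico (0 : ℝ) m) : Integrable (fun a => R (β / a)) Q := by
  have hm : 0 < m := hβ.1.trans_lt hβ.2
  have hcont : ContinuousOn (fun a => R (β / a)) (Icc m 1) :=
    hR.comp (continuousOn_const.div continuousOn_id fun a ha => (hm.trans_le ha.1).ne')
      fun a ha => div_mem_Ico_zero_one hβ ha
  have h := hcont.integrableOn_Icc (μ := Q)
  rwa [IntegrableOn, Measure.restrict_eq_self_of_ae_mem hQ] at h

theorem continuousOn_integral_comp_div (hR : ContinuousOn R (Ico 0 1))
    (hmono : StrictMonoOn R (Ico 0 1)) (hR0 : R 0 = 0) (hQ : ∀ᵐ a ∂Q, a ∈ Icc m 1) :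
    ContinuousOn (fun β => ∫ a, R (β / a) ∂Q) (Ico 0 m) := by
  intro β hβ
  have hm : 0 < m := hβ.1.trans_lt hβ.2
  obtain ⟨r, hβr, hrm⟩ := exists_between hβ.2
  have hr : r ∈ Ico 0 m := ⟨hβ.1.trans hβr.le, hrm⟩
  refine continuousWithinAt_of_dominated (bound := fun a => R (r / a)) ?_ ?_
    (integrable_comp_div hR hQ hr) ?_
  · filter_upwards [self_mem_nhdsWithin] with x hx
    exact (integrable_comp_div hR hQ hx).aestronglyMeasurable
  · filter_upwards [self_mem_nhdsWithin, mem_nhdsWithin_of_mem_nhds (Iio_mem_nhds hβr)]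
      with x hx hxr
    filter_upwards [hQ] with a ha
    have hxa := div_mem_Ico_zero_one hx ha
    have h0 : 0 ≤ R (x / a) := by
      rw [← hR0]
      exact hmono.monotoneOn ⟨le_rfl, one_pos⟩ hxa hxa.1
    rw [Real.norm_of_nonneg h0]
    exact hmono.monotoneOn hxa (div_mem_Ico_zero_one hr ha)
      (div_le_div_of_nonneg_right (le_of_lt hxr) (hm.le.trans ha.1))
  · filter_upwards [hQ] with a ha
    exact ContinuousWithinAt.comp (f := fun β => β / a) (hR _ (div_mem_Ico_zero_one hβ ha))
      (continuousWithinAt_id.div_const a) fun x hx => div_mem_Ico_zero_one hx ha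

theorem strictMonoOn_integral_comp_div (hR : ContinuousOn R (Ico 0 1))
    (hmono : StrictMonoOn R (Ico 0 1)) (hQ : ∀ᵐ a ∂Q, a ∈ Icc m 1) :
    StrictMonoOn (fun β => ∫ a, R (β / a) ∂Q) (Ico 0 m) := by
  intro x hx y hy hxy
  have hm : 0 < m := hx.1.trans_lt hx.2
  have hlt : ∀ᵐ a ∂Q, R (x / a) < R (y / a) := by
    filter_upwards [hQ] with a ha
    exact hmono (div_mem_Ico_zero_one hx ha) (div_mem_Ico_zero_one hy ha)
      (div_lt_div_of_pos_right hxy (hm.trans_le ha.1))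
  have hix := integrable_comp_div hR hQ hx
  have hiy := integrable_comp_div hR hQ hy
  have hle : (fun a => R (x / a)) ≤ᵐ[Q] fun a => R (y / a) := hlt.mono fun _ h => h.le
  refine lt_of_le_of_ne (integral_mono_ae hix hiy hle) fun h => ?_
  obtain ⟨a, ha, ha'⟩ := (hlt.and ((integral_eq_iff_of_ae_le hix hiy hle).1 h)).exists
  exact ha.ne ha'

end

theorem ae_sInf_support_le {Q : Measure ℝ} (h : 0 < sInf Q.support) :
    ∀ᵐ a ∂Q, sInf Q.support ≤ a := by
  have hbdd : BddBelow Q.support := by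
    by_contra hb
    rw [Real.sInf_of_not_bddBelow hb] at h
    exact h.false
  filter_upwards [Measure.support_mem_ae (μ := Q)] with a ha
  exact csInf_le hbdd ha

/-- Let `Q0` be a probability measure on `[0,1]` with
`m := inf supp Q0 > 0`. Then `R̄^{Q0}(β) := ∫ R(β/a) dQ0(a)` is finite (the integrand
is integrable and the defining series of `R(β/a)` is a.e. summable) for every
`β ∈ [0,m)`, satisfies `R̄^{Q0}(0) = 0`, and is continuous and strictly increasing
on `[0,m)`. -/
theorem statement6
    (g : ℕ → ℝ) (hg_mono : Monotone g) (hg0 : g 0 = 0) (hg1 : 0 < g 1)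
    (hg_lim : Filter.Tendsto g Filter.atTop (nhds 1))
    (hg_sup : (⨆ n, g n) = 1)
    (gfact : ℕ → ℝ) (hgfact : ∀ n, gfact n = ∏ k ∈ Finset.range n, g (k + 1))
    (Z : ℝ → ℝ) (hZ : ∀ β, Z β = ∑' ℓ : ℕ, β ^ ℓ / gfact ℓ)
    (θ : ℝ → ℕ → ℝ) (hθ : ∀ β n, θ β n = (Z β)⁻¹ * β ^ n / gfact n)
    (R : ℝ → ℝ) (hR : ∀ β, R β = ∑' n : ℕ, (n : ℝ) * θ β n)
    (Q0 : Measure ℝ) (hQ0prob : IsProbabilityMeasure Q0)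
    (hQ0supp : Q0 (Set.Icc (0 : ℝ) 1)ᶜ = 0)
    -- m is the infimum of the topological support of Q0
    (m : ℝ) (hm : m = sInf {a : ℝ | ∀ U ∈ nhds a, 0 < Q0 U}) (hmpos : 0 < m)
    (Rbar : ℝ → ℝ) (hRbar : ∀ β, Rbar β = ∫ a, R (β / a) ∂Q0) :
    (∀ β ∈ Set.Ico (0 : ℝ) m,
      Integrable (fun a => R (β / a)) Q0 ∧
      ∀ᵐ a ∂Q0, Summable fun n : ℕ => (n : ℝ) * θ (β / a) n) ∧
    Rbar 0 = 0 ∧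
    ContinuousOn Rbar (Set.Ico (0 : ℝ) m) ∧
    StrictMonoOn Rbar (Set.Ico (0 : ℝ) m) := by
  have hgpos : ∀ n, 0 < g (n + 1) := fun n => hg1.trans_le (hg_mono (by omega))
  have hfpos : ∀ n, 0 < gfact n := fun n => by
    rw [hgfact]
    exact Finset.prod_pos fun k _ => hgpos k
  set w : ℕ → ℝ := fun n => (gfact n)⁻¹ with hwdef
  have hw : ∀ n, 0 < w n := fun n => inv_pos.2 (hfpos n)
  have hratio : Tendsto (fun n => w (n + 1) / w n) atTop (nhds 1) := by
    have h : Tendsto (fun n => (g (n + 1))⁻¹) atTop (nhds 1) := by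
      simpa using (hg_lim.comp (tendsto_add_atTop_nat 1)).inv₀ one_ne_zero
    refine h.congr fun n => ?_
    have h1 : gfact (n + 1) = gfact n * g (n + 1) := by
      rw [hgfact, hgfact, Finset.prod_range_succ]
    have := (hgpos n).ne'
    have := (hfpos n).ne'
    simp only [hwdef, h1]
    field_simp
  have hratio' : Tendsto (fun n : ℕ => ((n + 1 : ℕ) * w (n + 1)) / (n * w n)) atTop (nhds 1) := by
    have h : Tendsto (fun n : ℕ => (1 + 1 / (n : ℝ)) * (w (n + 1) / w n)) atTop (nhds 1) := by
      simpa using (tendsto_one_div_atTop_nhds_zero_nat.const_add (1 : ℝ)).mul hratio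
    refine h.congr' ?_
    filter_upwards [eventually_gt_atTop 0] with n hn
    have := (hw n).ne'
    have : (n : ℝ) ≠ 0 := by positivity
    push_cast
    field_simp
  have hs : ∀ x ∈ Ico (0 : ℝ) 1, Summable fun n => w n * x ^ n := fun x hx =>
    summable_mul_pow_of_ratio_tendsto_one (.of_forall hw) hratio hx
  have hs' : ∀ x ∈ Ico (0 : ℝ) 1, Summable fun n : ℕ => (n * w n) * x ^ n := fun x hx =>
    summable_mul_pow_of_ratio_tendsto_one (c := fun n : ℕ => n * w n)
      ((eventually_gt_atTop 0).mono fun n hn => mul_pos (Nat.cast_pos.2 hn) (hw n)) hratio' hx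
  have hθw : ∀ x, (fun n : ℕ => (n : ℝ) * θ x n) = fun n : ℕ => (Z x)⁻¹ * ((n * w n) * x ^ n) := by
    intro x
    funext n
    rw [hθ, hwdef]
    ring
  have hRw : R = powerSeriesMean w := by
    funext x
    rw [hR, hθw, tsum_mul_left, hZ, powerSeriesMean, div_eq_inv_mul]
    simp only [hwdef, div_eq_inv_mul]
  subst hRw
  have hcont := continuousOn_powerSeriesMean hw hs hs'
  have hmono := strictMonoOn_powerSeriesMean hw hs hs'
  have hsupp : {a : ℝ | ∀ U ∈ nhds a, 0 < Q0 U} = Q0.support :=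
    Set.ext fun a => (Measure.mem_support_iff_forall a).symm
  have hQ : ∀ᵐ a ∂Q0, a ∈ Icc m 1 := by
    rw [hsupp] at hm
    have hle := ae_sInf_support_le (hm ▸ hmpos)
    rw [← hm] at hle
    filter_upwards [hle, mem_ae_iff.2 hQ0supp] with a h1 h2
    exact ⟨h1, h2.2⟩
  obtain rfl : Rbar = _ := funext hRbar
  refine ⟨fun β hβ => ⟨integrable_comp_div hcont hQ hβ, ?_⟩, ?_,
    continuousOn_integral_comp_div hcont hmono (powerSeriesMean_zero w) hQ,
    strictMonoOn_integral_comp_div hcont hmono hQ⟩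
  · filter_upwards [hQ] with a ha
    rw [hθw]
    exact (hs' _ (div_mem_Ico_zero_one hβ ha)).mul_left _
  · simp [powerSeriesMean_zero]
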